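/- arXiv:1409.7975 — 3 statements merged into one kernel-verified Lean document; each statement's English description precedes it below -/
import Mathlib

section
/- Let ξ and ξ' be i.i.d. real random variables, let s>0, and let τ ∈ (0, 1/2]. If P{ |ξ−ξ'| > s } ≥ 2τ, then the concentration function satisfies Q(ξ, s/2) ≤ √(1−2τ) ≤ 1−τ. -/
open MeasureTheory ProbabilityTheory Real

/-- If `ξ, ξ'` are i.i.d. real random variables, `s > 0`, `τ ∈ (0, 1/2]` and
`P{|ξ - ξ'| > s} ≥ 2τ`, then the concentration function satisfies
`Q(ξ, s/2) ≤ √(1 - 2τ) ≤ 1 - τ`. -/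
theorem stmt_7 {Ω : Type*} [MeasurableSpace Ω] (μ : Measure Ω) [IsProbabilityMeasure μ]
    (ξ ξ' : Ω → ℝ) (hξ : Measurable ξ) (hξ' : Measurable ξ')
    (hind : IndepFun ξ ξ' μ) (hid : IdentDistrib ξ ξ' μ μ)
    (s τ : ℝ) (hs : 0 < s) (hτ0 : 0 < τ) (hτ : τ ≤ 1 / 2)
    (hgap : ENNReal.ofReal (2 * τ) ≤ μ {ω | s < |ξ ω - ξ' ω|}) :
    (∀ lam : ℝ, μ {ω | |ξ ω - lam| ≤ s / 2} ≤ ENNReal.ofReal (Real.sqrt (1 - 2 * τ))) ∧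
      Real.sqrt (1 - 2 * τ) ≤ 1 - τ := by
  refine ⟨fun lam => ?_, Real.sqrt_le_iff.mpr ⟨by linarith, by nlinarith [sq_nonneg τ]⟩⟩
  have hball : MeasurableSet {x : ℝ | |x - lam| ≤ s / 2} :=
    measurableSet_le (by fun_prop) measurable_const
  have hgap_meas : MeasurableSet {ω | s < |ξ ω - ξ' ω|} :=
    measurableSet_lt measurable_const (by fun_prop)
  have hinter := hind.measure_inter_preimage_eq_mul _ _ hball hball
  rw [← hid.measure_mem_eq hball] at hinter
  have hsub : ξ ⁻¹' {x | |x - lam| ≤ s / 2} ∩ ξ' ⁻¹' {x | |x - lam| ≤ s / 2} ⊆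
      {ω | s < |ξ ω - ξ' ω|}ᶜ := by
    rintro ω ⟨h, h'⟩
    simp only [Set.mem_preimage, Set.mem_ofPred_eq, Set.mem_compl_iff, not_lt] at h h' ⊢
    rw [abs_le] at h h' ⊢
    constructor <;> linarith
  have hreal : μ.real (ξ ⁻¹' {x | |x - lam| ≤ s / 2}) ^ 2 ≤ 1 - 2 * τ := by
    have hle : 2 * τ ≤ μ.real {ω | s < |ξ ω - ξ' ω|} :=
      (ENNReal.ofReal_le_iff_le_toReal (measure_ne_top _ _)).mp hgap
    have hmono := measureReal_mono (μ := μ) hsub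
    rw [probReal_compl_eq_one_sub hgap_meas, measureReal_def, hinter, ENNReal.toReal_mul,
      ← measureReal_def] at hmono
    nlinarith
  exact (ENNReal.le_ofReal_iff_toReal_le (measure_ne_top _ _) (Real.sqrt_nonneg _)).mpr
    (Real.le_sqrt_of_sq_le hreal)
end

section
/- Let ξ and ξ' be real random variables whose joint distribution satisfies, for all Borel K,K' ⊂ ℝ: P{(ξ,ξ') ∈ K×K'} = P{ξ∈H∩K}·P{ξ∈H∩K'}/P{ξ∈H} + P{ξ∈H̄∩K∩K'}, where H = H₁ ∪ H₂ for disjoint Borel sets H₁,H₂ ⊂ ℝ with dist(H₁,H₂) ≥ d and min(P{ξ∈H₁}, P{ξ∈H₂}) ≥ r for some d,r>0, and P{ξ∈H}>0. Then P{ |ξ_H − ξ'_H| ≥ d } ≥ r, and the concentration function satisfies Q(ξ_H − ξ'_H, d/2) ≤ 1 − r/2. -/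
open MeasureTheory ProbabilityTheory Real
open scoped Classical

/-- The `H`-part of a real number: `s_H = s` if `s ∈ H` and `s_H = 0` otherwise. -/
noncomputable def Hpart (H : Set ℝ) (s : ℝ) : ℝ := if s ∈ H then s else 0

/-- The `H`-part map of a measurable set is measurable. -/
theorem measurable_Hpart {H : Set ℝ} (hH : MeasurableSet H) : Measurable (Hpart H) :=
  Measurable.ite hH measurable_id measurable_const

/-- The harmonic mean of two positive reals dominates any lower bound of both. -/
theorem le_harmonicMean {r a b : ℝ} (hr : 0 < r) (ha : r ≤ a) (hb : r ≤ b) :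
    r ≤ a * b / (a + b) + b * a / (a + b) := by
  rw [← add_div, le_div_iff₀ (by linarith)]
  nlinarith

/-- If `(ξ, ξ')` have the joint distribution making them conditionally i.i.d. given
`{ξ ∈ H}` and identical on `{ξ ∈ H̄}`, where `H = H₁ ∪ H₂` with `dist(H₁,H₂) ≥ d` and
`min(P{ξ ∈ H₁}, P{ξ ∈ H₂}) ≥ r`, then `P{|ξ_H - ξ'_H| ≥ d} ≥ r` and
`Q(ξ_H - ξ'_H, d/2) ≤ 1 - r/2`. -/
theorem stmt_10 {Ω : Type*} [MeasurableSpace Ω] (μ : Measure Ω) [IsProbabilityMeasure μ]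
    (ξ ξ' : Ω → ℝ) (hξ : Measurable ξ) (hξ' : Measurable ξ')
    (H₁ H₂ : Set ℝ) (hH₁ : MeasurableSet H₁) (hH₂ : MeasurableSet H₂)
    (hdisj : Disjoint H₁ H₂)
    (d r : ℝ) (hd : 0 < d) (hr : 0 < r)
    (hsep : ∀ x ∈ H₁, ∀ z ∈ H₂, d ≤ |x - z|)
    (h₁ : ENNReal.ofReal r ≤ μ {ω | ξ ω ∈ H₁})
    (h₂ : ENNReal.ofReal r ≤ μ {ω | ξ ω ∈ H₂})
    (hpos : 0 < μ {ω | ξ ω ∈ H₁ ∪ H₂})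
    (hjoint : ∀ K K' : Set ℝ, MeasurableSet K → MeasurableSet K' →
      μ {ω | ξ ω ∈ K ∧ ξ' ω ∈ K'} =
        μ {ω | ξ ω ∈ (H₁ ∪ H₂) ∩ K} * μ {ω | ξ ω ∈ (H₁ ∪ H₂) ∩ K'} /
          μ {ω | ξ ω ∈ H₁ ∪ H₂} +
        μ {ω | ξ ω ∈ (H₁ ∪ H₂)ᶜ ∩ K ∩ K'}) :
    ENNReal.ofReal r ≤
      μ {ω | d ≤ |Hpart (H₁ ∪ H₂) (ξ ω) - Hpart (H₁ ∪ H₂) (ξ' ω)|} ∧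
    ∀ lam : ℝ,
      μ {ω | |Hpart (H₁ ∪ H₂) (ξ ω) - Hpart (H₁ ∪ H₂) (ξ' ω) - lam| ≤ d / 2} ≤
        ENNReal.ofReal (1 - r / 2) := by
  have hm : MeasurableSet (H₁ ∪ H₂) := hH₁.union hH₂
  have hH := measurable_Hpart hm
  have hsymm : μ.map (fun ω => (ξ ω, ξ' ω)) = μ.map (fun ω => (ξ' ω, ξ ω)) := by
    have := Measure.isFiniteMeasure_map μ (fun ω => (ξ ω, ξ' ω))
    refine Measure.ext_prod fun {K K'} hK hK' => ?_
    rw [Measure.map_apply (hξ.prodMk hξ') (hK.prod hK'),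
      Measure.map_apply (hξ'.prodMk hξ) (hK.prod hK')]
    have e : (fun ω => (ξ' ω, ξ ω)) ⁻¹' K ×ˢ K' = {ω | ξ ω ∈ K' ∧ ξ' ω ∈ K} := by
      ext ω; simp [and_comm]
    rw [e, hjoint K' K hK' hK]
    refine (hjoint K K' hK hK').trans ?_
    rw [mul_comm, Set.inter_right_comm]
  set D : Ω → ℝ := fun ω => Hpart (H₁ ∪ H₂) (ξ ω) - Hpart (H₁ ∪ H₂) (ξ' ω) with hD
  have hDm : Measurable D := (hH.comp hξ).sub (hH.comp hξ')
  have hDsymm : μ.real {ω | d ≤ D ω} = μ.real {ω | D ω ≤ -d} := by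
    have hS : MeasurableSet {p : ℝ × ℝ | d ≤ Hpart (H₁ ∪ H₂) p.1 - Hpart (H₁ ∪ H₂) p.2} :=
      measurableSet_le measurable_const
        ((hH.comp measurable_fst).sub (hH.comp measurable_snd))
    have e := congrArg (fun ν => ν {p : ℝ × ℝ |
      d ≤ Hpart (H₁ ∪ H₂) p.1 - Hpart (H₁ ∪ H₂) p.2}) hsymm
    rw [Measure.map_apply (hξ.prodMk hξ') hS, Measure.map_apply (hξ'.prodMk hξ) hS] at e
    have e' : {ω | D ω ≤ -d} = (fun ω => (ξ' ω, ξ ω)) ⁻¹'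
        {p : ℝ × ℝ | d ≤ Hpart (H₁ ∪ H₂) p.1 - Hpart (H₁ ∪ H₂) p.2} := by
      ext ω
      simp only [hD, Set.mem_ofPred_eq, Set.mem_preimage]
      constructor <;> intro h <;> linarith
    rw [e']
    exact congrArg ENNReal.toReal e
  have hcross : ∀ A B : Set ℝ, MeasurableSet A → MeasurableSet B → Disjoint A B →
      A ⊆ H₁ ∪ H₂ → B ⊆ H₁ ∪ H₂ →
      μ.real {ω | ξ ω ∈ A ∧ ξ' ω ∈ B} =
        μ.real {ω | ξ ω ∈ A} * μ.real {ω | ξ ω ∈ B} / μ.real {ω | ξ ω ∈ H₁ ∪ H₂} := by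
    intro A B hA hB hAB hAH hBH
    have e := hjoint A B hA hB
    rw [Set.inter_eq_right.2 hAH, Set.inter_eq_right.2 hBH, Set.inter_assoc,
      hAB.inter_eq, Set.inter_empty] at e
    simp only [Set.mem_empty_iff_false, Set.ofPred_false, measure_empty, add_zero] at e
    simp only [Measure.real, e, ENNReal.toReal_div, ENNReal.toReal_mul]
  have hsum : μ.real {ω | ξ ω ∈ H₁ ∪ H₂} =
      μ.real {ω | ξ ω ∈ H₁} + μ.real {ω | ξ ω ∈ H₂} :=
    measureReal_union (hdisj.preimage ξ) (hξ hH₂)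
  have h₁' : r ≤ μ.real {ω | ξ ω ∈ H₁} :=
    (ENNReal.ofReal_le_iff_le_toReal (measure_ne_top _ _)).1 h₁
  have h₂' : r ≤ μ.real {ω | ξ ω ∈ H₂} :=
    (ENNReal.ofReal_le_iff_le_toReal (measure_ne_top _ _)).1 h₂
  have habs : r ≤ μ.real {ω | d ≤ |D ω|} := by
    have hle := le_harmonicMean hr h₁' h₂'
    rw [← hsum, ← hcross H₁ H₂ hH₁ hH₂ hdisj Set.subset_union_left Set.subset_union_right,
      ← hcross H₂ H₁ hH₂ hH₁ hdisj.symm Set.subset_union_right Set.subset_union_left,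
      ← measureReal_union (μ := μ) (s₁ := {ω | ξ ω ∈ H₁ ∧ ξ' ω ∈ H₂})
        (s₂ := {ω | ξ ω ∈ H₂ ∧ ξ' ω ∈ H₁}) _ ((hξ hH₂).inter (hξ' hH₁))] at hle
    · refine hle.trans (measureReal_mono ?_)
      rintro ω (⟨h, h'⟩ | ⟨h, h'⟩)
      · simpa [hD, Hpart, h, h'] using hsep _ h _ h'
      · simpa [hD, Hpart, h, h', abs_sub_comm] using hsep _ h' _ h
    · exact Set.disjoint_left.2 fun ω h h' => Set.disjoint_left.1 hdisj h.1 h'.1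
  refine ⟨(ENNReal.ofReal_le_iff_le_toReal (measure_ne_top _ _)).2 habs, fun lam => ?_⟩
  have hhalf : r / 2 ≤ μ.real {ω | d ≤ D ω} := by
    have : μ.real {ω | d ≤ |D ω|} ≤ μ.real {ω | d ≤ D ω} + μ.real {ω | D ω ≤ -d} := by
      refine (measureReal_mono fun ω h => ?_).trans (measureReal_union_le _ _)
      rcases le_abs.1 (show d ≤ |D ω| from h) with h | h
      · exact Or.inl h
      · exact Or.inr (show D ω ≤ -d by linarith)
    linarith
  have hcompl : ∀ S T : Set Ω, MeasurableSet S → T ⊆ Sᶜ → r / 2 ≤ μ.real S →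
      μ T ≤ ENNReal.ofReal (1 - r / 2) := by
    intro S T hS hT hrS
    refine ENNReal.le_ofReal_iff_toReal_le (measure_ne_top _ _) ?_ |>.2 ?_
    · linarith [measureReal_le_one (μ := μ) (s := S)]
    · refine (measureReal_mono hT).trans ?_
      rw [probReal_compl_eq_one_sub hS]
      linarith
  rcases le_total lam 0 with hl | hl
  · refine hcompl _ _ (measurableSet_le measurable_const hDm) (fun ω h h' => ?_) hhalf
    have h1 := (abs_le.1 (show |D ω - lam| ≤ d / 2 from h)).2
    have h2 : d ≤ D ω := h'
    linarith
  · refine hcompl _ _ (measurableSet_le hDm measurable_const) (fun ω h h' => ?_)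
      (hDsymm ▸ hhalf)
    have h1 := (abs_le.1 (show |D ω - lam| ≤ d / 2 from h)).1
    have h2 : D ω ≤ -d := h'
    linarith
end

section
/- There is a universal constant c>0 with the following property. Let ξ be a real random variable such that for some z∈ℝ, γ>0 and N∈ℕ, min( P{z−√N ≤ ξ ≤ z−1}, P{z+1 ≤ ξ ≤ z+√N} ) ≥ γ. Then there exist an integer ℓ with 0 ≤ ℓ ≤ ⌊log₂ √N⌋, a real number λ, and disjoint Borel sets H₁,H₂ ⊂ [−2^{ℓ+2}, 2^{ℓ+2}] such that dist(H₁,H₂) ≥ 2^ℓ, min( P{ξ−λ ∈ H₁}, P{ξ−λ ∈ H₂} ) ≥ c·γ·2^{−ℓ/8}, and E[(ξ−λ)_H] = 0 for H = H₁ ∪ H₂. -/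
open MeasureTheory ProbabilityTheory Real
open scoped Classical

/-- Either an interval of length `4d` carries two pieces of mass at least `t` at distance `d`, or
all but `2t` of its mass sits in an interval of length `2d`. -/
theorem exists_separated_or_concentrated (ν : Measure ℝ) [IsFiniteMeasure ν] {d t : ℝ}
    (ht : 0 < t) (u : ℝ) (hI : t ≤ ν.real (Set.Ioo u (u + 4 * d))) :
    (∃ x, t ≤ ν.real (Set.Ioo u (u + 4 * d) ∩ Set.Iic x) ∧
        t ≤ ν.real (Set.Ioo u (u + 4 * d) ∩ Set.Ici (x + d))) ∨
      ∃ v, ν.real (Set.Ioo v (v + 2 * d))ᶜ ≤ ν.real (Set.Ioo u (u + 4 * d))ᶜ + 2 * t := by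
  set I := Set.Ioo u (u + 4 * d) with hIdef
  obtain ⟨k, hk, hk'⟩ : ∃ k : ℕ, ν.real (I ∩ Set.Iic (u + k * d)) < t ∧
      t ≤ ν.real (I ∩ Set.Iic (u + (k + 1 : ℕ) * d)) := by
    by_contra! h
    have hall : ∀ k : ℕ, ν.real (I ∩ Set.Iic (u + k * d)) < t := by
      intro k
      induction k with
      | zero =>
        have : I ∩ Set.Iic (u + (0 : ℕ) * d) = ∅ := by
          ext y
          simp only [hIdef, Set.mem_inter_iff, Set.mem_Ioo, Set.mem_Iic, Set.mem_empty_iff_false,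
            iff_false, Nat.cast_zero, zero_mul, add_zero]
          rintro ⟨⟨h1, -⟩, h2⟩
          linarith
        rw [this]
        simpa using ht
      | succ k ih => exact h k ih
    have h4 : I ∩ Set.Iic (u + (4 : ℕ) * d) = I := by
      refine Set.inter_eq_left.2 fun y hy => ?_
      simpa using hy.2.le
    have := hall 4
    rw [h4] at this
    linarith
  by_cases hx : t ≤ ν.real (I ∩ Set.Ici (u + (k + 1 : ℕ) * d + d))
  · exact Or.inl ⟨_, hk', hx⟩
  · refine Or.inr ⟨u + k * d, ?_⟩
    have hsub : (Set.Ioo (u + k * d) (u + k * d + 2 * d))ᶜ ⊆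
        Iᶜ ∪ (I ∩ Set.Iic (u + k * d)) ∪ (I ∩ Set.Ici (u + (k + 1 : ℕ) * d + d)) := by
      intro y hy
      by_cases hyI : y ∈ I
      · by_cases h1 : y ≤ u + k * d
        · exact Or.inl (Or.inr ⟨hyI, h1⟩)
        · refine Or.inr ⟨hyI, ?_⟩
          simp only [Set.mem_compl_iff, Set.mem_Ioo, not_and, not_lt] at hy
          have := hy (not_le.1 h1)
          simp only [Set.mem_Ici]
          push_cast
          linarith
      · exact Or.inl (Or.inl hyI)
    have h1 := measureReal_mono (μ := ν) hsub
    have h2 := measureReal_union_le (μ := ν) (Iᶜ ∪ (I ∩ Set.Iic (u + k * d)))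
      (I ∩ Set.Ici (u + (k + 1 : ℕ) * d + d))
    have h3 := measureReal_union_le (μ := ν) Iᶜ (I ∩ Set.Iic (u + k * d))
    linarith

/-- A measure supported on `[z - M, z + M]` with mass `γ` on each side of `(z - 1, z + 1)` has, at
some dyadic scale `2 ^ ℓ`, two separated pieces of mass proportional to `γ * r ^ ℓ`. -/
theorem exists_separated_scale (ν : Measure ℝ) [IsFiniteMeasure ν] {z M γ r : ℝ} {L : ℕ}
    (hγ : 0 < γ) (hr0 : 0 < r) (hr1 : r < 1) (hM : M < 2 ^ (L + 1))
    (hsupp : ν (Set.Icc (z - M) (z + M))ᶜ = 0)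
    (hl : γ ≤ ν.real (Set.Iic (z - 1))) (hu : γ ≤ ν.real (Set.Ici (z + 1))) :
    ∃ ℓ ≤ L, ∃ u x : ℝ,
      (1 - r) / 4 * γ * r ^ ℓ ≤ ν.real (Set.Ioo u (u + 4 * 2 ^ ℓ) ∩ Set.Iic x) ∧
      (1 - r) / 4 * γ * r ^ ℓ ≤ ν.real (Set.Ioo u (u + 4 * 2 ^ ℓ) ∩ Set.Ici (x + 2 ^ ℓ)) := by
  by_contra! hcon
  have htot : γ ≤ ν.real Set.univ := hl.trans (measureReal_mono (Set.subset_univ _))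
  have key : ∀ ℓ ≤ L + 1, ∃ v, ν.real (Set.Ioo v (v + 2 * 2 ^ ℓ))ᶜ ≤ γ / 2 * r ^ ℓ := by
    intro ℓ hℓ
    induction hℓ using Nat.decreasingInduction with
    | self =>
      refine ⟨z - 2 ^ (L + 1), ?_⟩
      have h0 : ν (Set.Ioo (z - 2 ^ (L + 1)) (z - 2 ^ (L + 1) + 2 * 2 ^ (L + 1)))ᶜ = 0 := by
        refine measure_mono_null (Set.compl_subset_compl.2 fun y hy => ?_) hsupp
        exact ⟨by linarith [hy.1], by linarith [hy.2]⟩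
      rw [measureReal_def, h0]
      simp only [ENNReal.toReal_zero]
      positivity
    | of_succ ℓ hℓ ih =>
      obtain ⟨u, hu⟩ := ih
      have hlen : (2 : ℝ) * 2 ^ (ℓ + 1) = 4 * 2 ^ ℓ := by ring
      rw [hlen] at hu
      have hrp : 0 < r ^ ℓ := pow_pos hr0 ℓ
      have hrp1 : r ^ ℓ ≤ 1 := pow_le_one₀ hr0.le hr1.le
      have hrs1 : r ^ (ℓ + 1) ≤ 1 := pow_le_one₀ hr0.le hr1.le
      have ht : 0 < (1 - r) / 4 * γ * r ^ ℓ := by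
        have : 0 < 1 - r := by linarith
        positivity
      have ht' : (1 - r) / 4 * γ * r ^ ℓ ≤ γ / 2 := by
        calc (1 - r) / 4 * γ * r ^ ℓ ≤ (1 - r) / 4 * γ * 1 := by
              have : 0 < 1 - r := by linarith
              gcongr
          _ ≤ γ / 2 := by nlinarith
      have hcompl := measureReal_add_measureReal_compl (μ := ν)
        (measurableSet_Ioo (a := u) (b := u + 4 * 2 ^ ℓ))
      have hI : (1 - r) / 4 * γ * r ^ ℓ ≤ ν.real (Set.Ioo u (u + 4 * 2 ^ ℓ)) := by nlinarith
      rcases exists_separated_or_concentrated ν ht u hI with ⟨x, h1, h2⟩ | ⟨v, hv⟩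
      · exact absurd h2 (not_le.2 (hcon ℓ (by omega) u x h1))
      · refine ⟨v, hv.trans ?_⟩
        rw [pow_succ] at hu
        nlinarith
  obtain ⟨v, hv⟩ := key 0 (Nat.zero_le _)
  simp only [pow_zero, mul_one] at hv
  rcases le_or_gt v (z - 1) with h | h
  · have : Set.Ici (z + 1) ⊆ (Set.Ioo v (v + 2))ᶜ := fun y hy hy' => by
      have h1 : z + 1 ≤ y := hy
      linarith [hy'.2]
    linarith [measureReal_mono (μ := ν) this]
  · have : Set.Iic (z - 1) ⊆ (Set.Ioo v (v + 2))ᶜ := fun y hy hy' => by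
      have h1 : y ≤ z - 1 := hy
      linarith [hy'.1]
    linarith [measureReal_mono (μ := ν) this]

/-- A random variable restricted to an event of positive probability on which it takes values in
`[u, v]` can be centred by some `lam ∈ [u, v]`. -/
theorem exists_centering {Ω : Type*} [MeasurableSpace Ω] (μ : Measure Ω) [IsFiniteMeasure μ]
    {ξ : Ω → ℝ} (hξ : Measurable ξ) {A : Set ℝ} (hA : MeasurableSet A) {u v : ℝ}
    (hAuv : A ⊆ Set.Icc u v) (hpos : μ (ξ ⁻¹' A) ≠ 0) :
    ∃ lam ∈ Set.Icc u v, ∫ ω, Hpart {s | s + lam ∈ A} (ξ ω - lam) ∂μ = 0 := by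
  have hmem : ∀ᵐ ω ∂μ.restrict (ξ ⁻¹' A), ξ ω ∈ Set.Icc u v := by
    filter_upwards [ae_restrict_mem (hξ hA)] with ω hω using hAuv hω
  have hint : IntegrableOn ξ (ξ ⁻¹' A) μ := by
    exact Integrable.of_mem_Icc u v hξ.aemeasurable hmem
  refine ⟨⨍ ω in ξ ⁻¹' A, ξ ω ∂μ,
    (convex_Icc u v).set_average_mem isClosed_Icc hpos (measure_ne_top _ _) hmem hint, ?_⟩
  set lam := ⨍ ω in ξ ⁻¹' A, ξ ω ∂μ
  have hfun : (fun ω => Hpart {s | s + lam ∈ A} (ξ ω - lam)) =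
      (ξ ⁻¹' A).indicator fun ω => ξ ω - lam := by
    ext ω
    simp [Hpart, Set.indicator_apply]
  rw [hfun, integral_indicator (hξ hA)]
  have : NeZero (μ.restrict (ξ ⁻¹' A)) := ⟨by simpa using hpos⟩
  exact integral_sub_average _ ξ

/-- Lemma 4.3 (interval detection): there is a universal constant `c > 0` such that if a
random variable `ξ` satisfies `min(P{z - √N ≤ ξ ≤ z - 1}, P{z + 1 ≤ ξ ≤ z + √N}) ≥ γ`,
then there exist an integer `0 ≤ ℓ ≤ ⌊log₂ √N⌋`, `λ ∈ ℝ` and disjoint Borel sets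
`H₁, H₂ ⊆ [-2^{ℓ+2}, 2^{ℓ+2}]` with `dist(H₁, H₂) ≥ 2^ℓ`,
`min(P{ξ - λ ∈ H₁}, P{ξ - λ ∈ H₂}) ≥ c γ 2^{-ℓ/8}` and `E[(ξ - λ)_H] = 0` for
`H = H₁ ∪ H₂`. -/
theorem stmt_14 :
    ∃ c : ℝ, 0 < c ∧
      ∀ (Ω : Type) (_ : MeasurableSpace Ω) (μ : Measure Ω), IsProbabilityMeasure μ →
      ∀ ξ : Ω → ℝ, Measurable ξ →
      ∀ (z γ : ℝ) (N : ℕ), 0 < γ →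
      ENNReal.ofReal γ ≤ μ {ω | z - Real.sqrt N ≤ ξ ω ∧ ξ ω ≤ z - 1} →
      ENNReal.ofReal γ ≤ μ {ω | z + 1 ≤ ξ ω ∧ ξ ω ≤ z + Real.sqrt N} →
      ∃ (ℓ : ℕ) (lam : ℝ) (H₁ H₂ : Set ℝ),
        (ℓ : ℝ) ≤ Real.logb 2 (Real.sqrt N) ∧
        MeasurableSet H₁ ∧ MeasurableSet H₂ ∧ Disjoint H₁ H₂ ∧
        H₁ ⊆ Set.Icc (-(2 : ℝ) ^ (ℓ + 2)) ((2 : ℝ) ^ (ℓ + 2)) ∧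
        H₂ ⊆ Set.Icc (-(2 : ℝ) ^ (ℓ + 2)) ((2 : ℝ) ^ (ℓ + 2)) ∧
        (∀ x ∈ H₁, ∀ x' ∈ H₂, (2 : ℝ) ^ ℓ ≤ |x - x'|) ∧
        ENNReal.ofReal (c * γ * 2 ^ (-(ℓ : ℝ) / 8)) ≤ μ {ω | ξ ω - lam ∈ H₁} ∧
        ENNReal.ofReal (c * γ * 2 ^ (-(ℓ : ℝ) / 8)) ≤ μ {ω | ξ ω - lam ∈ H₂} ∧
        ∫ ω, Hpart (H₁ ∪ H₂) (ξ ω - lam) ∂μ = 0 := by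
  have hr0 : (0 : ℝ) < 2 ^ (-(1 : ℝ) / 8) := by positivity
  have hr1 : (2 : ℝ) ^ (-(1 : ℝ) / 8) < 1 :=
    Real.rpow_lt_one_of_one_lt_of_neg (by norm_num) (by norm_num)
  set r : ℝ := 2 ^ (-(1 : ℝ) / 8) with hr
  refine ⟨(1 - r) / 4, by linarith, ?_⟩
  intro Ω _ μ _ ξ hξ z γ N hγ hl hu
  set M := Real.sqrt N
  have hM1 : 1 ≤ M := by
    by_contra! h
    have : {ω | z + 1 ≤ ξ ω ∧ ξ ω ≤ z + M} = ∅ := by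
      ext ω
      simp only [Set.mem_ofPred_eq, Set.mem_empty_iff_false, iff_false]
      rintro ⟨h1, h2⟩
      linarith
    rw [this, measure_empty, nonpos_iff_eq_zero, ENNReal.ofReal_eq_zero] at hu
    linarith
  have hlog : 0 ≤ Real.logb 2 M := Real.logb_nonneg (by norm_num) hM1
  have hML : M < 2 ^ (⌊Real.logb 2 M⌋₊ + 1) := by
    have := (Real.logb_lt_iff_lt_rpow (by norm_num) (by linarith)).1
      (Nat.lt_floor_add_one (Real.logb 2 M))
    exact_mod_cast this
  set S := Set.Icc (z - M) (z + M)
  set ν := (μ.map ξ).restrict S with hν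
  have : IsProbabilityMeasure (μ.map ξ) := Measure.isProbabilityMeasure_map hξ.aemeasurable
  have hν_apply : ∀ A, MeasurableSet A → ν A = μ (ξ ⁻¹' (A ∩ S)) := fun A hA => by
    rw [hν, Measure.restrict_apply hA, Measure.map_apply hξ (hA.inter measurableSet_Icc)]
  have hν_ge : ∀ A, MeasurableSet A → ∀ t : ℝ, t ≤ ν.real A →
      ENNReal.ofReal t ≤ μ (ξ ⁻¹' A) := fun A hA t ht =>
    (ENNReal.ofReal_le_of_le_toReal ht).trans <| by
      rw [hν_apply A hA]
      exact measure_mono (Set.preimage_mono Set.inter_subset_left)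
  have hsupp : ν Sᶜ = 0 := by
    rw [hν_apply _ measurableSet_Icc.compl, Set.compl_inter_self, Set.preimage_empty, measure_empty]
  have hl' : γ ≤ ν.real (Set.Iic (z - 1)) := by
    refine (ENNReal.ofReal_le_iff_le_toReal (measure_ne_top _ _)).1 (hl.trans ?_)
    rw [hν_apply _ measurableSet_Iic]
    exact measure_mono fun ω hω => ⟨hω.2, hω.1, by linarith [hω.2]⟩
  have hu' : γ ≤ ν.real (Set.Ici (z + 1)) := by
    refine (ENNReal.ofReal_le_iff_le_toReal (measure_ne_top _ _)).1 (hu.trans ?_)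
    rw [hν_apply _ measurableSet_Ici]
    exact measure_mono fun ω hω => ⟨hω.1, by linarith [hω.1], hω.2⟩
  obtain ⟨ℓ, hℓ, u, x, h1, h2⟩ := exists_separated_scale ν hγ hr0 hr1 hML hsupp hl' hu'
  set A₁ := Set.Ioo u (u + 4 * 2 ^ ℓ) ∩ Set.Iic x
  set A₂ := Set.Ioo u (u + 4 * 2 ^ ℓ) ∩ Set.Ici (x + 2 ^ ℓ)
  have hA₁ : MeasurableSet A₁ := measurableSet_Ioo.inter measurableSet_Iic
  have hA₂ : MeasurableSet A₂ := measurableSet_Ioo.inter measurableSet_Ici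
  have hd : (0 : ℝ) < 2 ^ ℓ := by positivity
  have hrℓ : (2 : ℝ) ^ (-(ℓ : ℝ) / 8) = r ^ ℓ := by
    rw [hr, ← Real.rpow_mul_natCast (by norm_num)]
    congr 1
    ring
  have ht : 0 < (1 - r) / 4 * γ * r ^ ℓ := by
    have : 0 < 1 - r := by linarith
    positivity
  have hm₁ := hν_ge _ hA₁ _ h1
  have hm₂ := hν_ge _ hA₂ _ h2
  have hA : A₁ ∪ A₂ ⊆ Set.Icc u (u + 4 * 2 ^ ℓ) :=
    Set.union_subset (fun y hy => Set.Ioo_subset_Icc_self hy.1)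
      fun y hy => Set.Ioo_subset_Icc_self hy.1
  have hpos : μ (ξ ⁻¹' (A₁ ∪ A₂)) ≠ 0 :=
    ((ENNReal.ofReal_pos.2 ht).trans_le
      (hm₁.trans (measure_mono (Set.preimage_mono Set.subset_union_left)))).ne'
  obtain ⟨lam, hlam, hcent⟩ := exists_centering μ hξ (hA₁.union hA₂) hA hpos
  have hsub : ∀ s, s + lam ∈ A₁ ∪ A₂ → s ∈ Set.Icc (-(2 : ℝ) ^ (ℓ + 2)) (2 ^ (ℓ + 2)) := by
    intro s hs
    have hs' := hA hs
    have hp : (2 : ℝ) ^ (ℓ + 2) = 4 * 2 ^ ℓ := by ring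
    rw [hp]
    exact ⟨by linarith [hs'.1, hlam.2], by linarith [hs'.2, hlam.1]⟩
  have hsep : ∀ s, s + lam ∈ A₁ → ∀ s', s' + lam ∈ A₂ → (2 : ℝ) ^ ℓ ≤ |s - s'| := by
    intro s hs s' hs'
    have e1 : s + lam ≤ x := hs.2
    have e2 : x + 2 ^ ℓ ≤ s' + lam := hs'.2
    rw [abs_sub_comm]
    exact le_trans (by linarith) (le_abs_self _)
  refine ⟨ℓ, lam, {s | s + lam ∈ A₁}, {s | s + lam ∈ A₂},
    (Nat.cast_le.2 hℓ).trans (Nat.floor_le hlog), measurable_add_const lam hA₁,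
    measurable_add_const lam hA₂, ?_,
    fun s hs => hsub s (Or.inl hs), fun s hs => hsub s (Or.inr hs),
    hsep, ?_, ?_, hcent⟩
  · refine Set.disjoint_left.2 fun s hs hs' => ?_
    have := hsep s hs s hs'
    rw [sub_self, abs_zero] at this
    linarith
  · rw [hrℓ]
    exact hm₁.trans (measure_mono fun ω hω => by simpa using hω)
  · rw [hrℓ]
    exact hm₂.trans (measure_mono fun ω hω => by simpa using hω)
end
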